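/- arXiv:2306.17260 — 2 statements merged into one kernel-verified Lean document; each statement's English description precedes it below -/
import Mathlib

section
/- The following weight-reduction identity holds: E[Σ_{t=1}^T W_t (A_t − p̃_t)² f_t (Z_t − μ_t)ᵀ] = E[Σ_{t=1}^T p̃_t (1 − p̃_t) f_t (Z_t − μ_t)ᵀ]; consequently the Gateaux derivative of the population A2-WCLS score for β₀ with respect to the nuisance parameter β₁, namely the linear map β₁ ↦ E[Σ_{t=1}^T W_t (A_t − p̃_t)² f_t (Z_t − μ_t)ᵀ] β₁, vanishes identically (Neyman orthogonality) if and only if the orthogonality condition (Condition 3.1) holds. -/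
open MeasureTheory ProbabilityTheory Matrix
open scoped BigOperators

theorem aux_pull {Ω : Type*} {m m0 : MeasurableSpace Ω} (hm : m ≤ m0) (P : Measure Ω)
    [IsProbabilityMeasure P] (B g r : Ω → ℝ) (hB : Integrable B P) (hg : StronglyMeasurable[m] g)
    (hBg : Integrable (fun ω => B ω * g ω) P) (hr : r =ᵐ[P] P[B | m]) :
    Integrable (fun ω => r ω * g ω) P ∧ ∫ ω, B ω * g ω ∂P = ∫ ω, r ω * g ω ∂P := by
  have h1 : P[B * g | m] =ᵐ[P] P[B | m] * g :=
    condExp_mul_of_stronglyMeasurable_right hg hBg hB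
  have h2 : P[B * g | m] =ᵐ[P] fun ω => r ω * g ω := by
    filter_upwards [h1, hr] with ω a b
    rw [a, b]; rfl
  refine ⟨integrable_condExp.congr h2, ?_⟩
  rw [← integral_congr_ae h2, integral_condExp hm]
  rfl

/-- The weight-reduction identity
`E[Σ_t W_t (A_t − p̃_t)² f_t (Z_t − μ_t)ᵀ] = E[Σ_t p̃_t(1 − p̃_t) f_t (Z_t − μ_t)ᵀ]` holds;
consequently the Gateaux derivative of the population A2-WCLS score for `β₀` with respect to
`β₁`, namely `β₁ ↦ E[Σ_t W_t (A_t − p̃_t)² f_t (Z_t − μ_t)ᵀ] β₁`, vanishes identically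
(Neyman orthogonality) iff the orthogonality condition (Condition 3.1) holds. -/
theorem stmt_9
    {Ω : Type*} [m𝒜 : MeasurableSpace Ω] (P : Measure Ω) [IsProbabilityMeasure P]
    (F : Filtration ℕ m𝒜) (T q pd : ℕ)
    (A : ℕ → Ω → ℝ)
    (hA : ∀ t, Measurable[F (t + 1)] (A t))
    (hAbin : ∀ t ω, A t ω = 0 ∨ A t ω = 1)
    (pr : ℕ → Ω → ℝ)
    (hprMeas : ∀ t, Measurable[F t] (pr t))
    (hpr01 : ∀ t ω, pr t ω ∈ Set.Ioo (0 : ℝ) 1)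
    (hprA : ∀ t, pr t =ᵐ[P] P[A t | F t])
    (𝒢 : ℕ → MeasurableSpace Ω) (h𝒢 : ∀ t, 𝒢 t ≤ F t)
    (ptil : ℕ → Ω → ℝ)
    (hptilMeas : ∀ t, Measurable[𝒢 t] (ptil t))
    (hptil01 : ∀ t ω, ptil t ω ∈ Set.Ioo (0 : ℝ) 1)
    (W : ℕ → Ω → ℝ)
    (hW : ∀ t ω, W t ω
      = A t ω * (ptil t ω / pr t ω) + (1 - A t ω) * ((1 - ptil t ω) / (1 - pr t ω)))
    (f : ℕ → Ω → Fin q → ℝ) (hf : ∀ t, Measurable[𝒢 t] (f t))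
    (Z : ℕ → Ω → Fin pd → ℝ) (hZ : ∀ t, Measurable[F t] (Z t))
    (μ : ℕ → Ω → Fin pd → ℝ) (hμ : ∀ t, Measurable[𝒢 t] (μ t))
    (hInt₁ : ∀ t i j, Integrable
      (fun ω => W t ω * (A t ω - ptil t ω) ^ 2 * f t ω i * (Z t ω j - μ t ω j)) P)
    (hInt₂ : ∀ t i j, Integrable
      (fun ω => ptil t ω * (1 - ptil t ω) * f t ω i * (Z t ω j - μ t ω j)) P)
    -- the q × p Gateaux-derivative matrix and the p × q orthogonality matrix
    (M : Matrix (Fin q) (Fin pd) ℝ)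
    (hM : ∀ i j, M i j = ∫ ω, ∑ t ∈ Finset.Icc 1 T,
      W t ω * (A t ω - ptil t ω) ^ 2 * f t ω i * (Z t ω j - μ t ω j) ∂P)
    (O : Matrix (Fin pd) (Fin q) ℝ)
    (hO : ∀ j i, O j i = ∫ ω, ∑ t ∈ Finset.Icc 1 T,
      ptil t ω * (1 - ptil t ω) * (Z t ω j - μ t ω j) * f t ω i ∂P) :
    -- the weight-reduction identity
    (∀ i j, M i j = ∫ ω, ∑ t ∈ Finset.Icc 1 T,
        ptil t ω * (1 - ptil t ω) * f t ω i * (Z t ω j - μ t ω j) ∂P) ∧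
    -- Neyman orthogonality ↔ Condition 3.1
    ((∀ β₁ : Fin pd → ℝ, M *ᵥ β₁ = 0) ↔ O = 0) := by
  have key : ∀ t i j,
      ∫ ω, W t ω * (A t ω - ptil t ω) ^ 2 * f t ω i * (Z t ω j - μ t ω j) ∂P
        = ∫ ω, ptil t ω * (1 - ptil t ω) * f t ω i * (Z t ω j - μ t ω j) ∂P := by
    intro t i j
    have hAm : Measurable (A t) := (hA t).mono (F.le _) le_rfl
    have hAb : ∀ ω, ‖A t ω‖ ≤ 1 := by
      intro ω; rcases hAbin t ω with h | h <;> simp [h]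
    have hAi : Integrable (A t) P :=
      Integrable.of_bound hAm.aestronglyMeasurable 1 (Filter.Eventually.of_forall hAb)
    have hpm : Measurable[F t] (ptil t) := (hptilMeas t).mono (h𝒢 t) le_rfl
    have hfm : Measurable[F t] (fun ω => f t ω i) :=
      (measurable_pi_apply i).comp ((hf t).mono (h𝒢 t) le_rfl)
    have hZm : Measurable[F t] (fun ω => Z t ω j) := (measurable_pi_apply j).comp (hZ t)
    have hμm : Measurable[F t] (fun ω => μ t ω j) :=
      (measurable_pi_apply j).comp ((hμ t).mono (h𝒢 t) le_rfl)
    have hrm := hprMeas t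
    let g1 : Ω → ℝ := fun ω =>
      ptil t ω / pr t ω * (1 - ptil t ω) ^ 2 * f t ω i * (Z t ω j - μ t ω j)
    let g0 : Ω → ℝ := fun ω =>
      (1 - ptil t ω) / (1 - pr t ω) * (ptil t ω) ^ 2 * f t ω i * (Z t ω j - μ t ω j)
    have hg1 : StronglyMeasurable[F t] g1 := by
      apply Measurable.stronglyMeasurable
      exact (((hpm.div hrm).mul ((hpm.const_sub 1).pow_const 2)).mul hfm).mul (hZm.sub hμm)
    have hg0 : StronglyMeasurable[F t] g0 := by
      apply Measurable.stronglyMeasurable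
      exact ((((hpm.const_sub 1).div (hrm.const_sub 1)).mul (hpm.pow_const 2)).mul hfm).mul
        (hZm.sub hμm)
    have hi1 : Integrable (fun ω => A t ω * g1 ω) P := by
      have := (hInt₁ t i j).bdd_mul hAm.aestronglyMeasurable (Filter.Eventually.of_forall hAb)
      refine this.congr (Filter.Eventually.of_forall fun ω => ?_)
      rcases hAbin t ω with h | h <;> simp [h, hW, g1]
    have hi0 : Integrable (fun ω => (1 - A t ω) * g0 ω) P := by
      refine ((hInt₁ t i j).sub hi1).congr (Filter.Eventually.of_forall fun ω => ?_)
      rcases hAbin t ω with h | h <;> simp [h, hW, g1, g0]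
    obtain ⟨a1, b1⟩ := aux_pull (F.le t) P (A t) g1 (pr t) hAi hg1 hi1 (hprA t)
    have hr0 : (fun ω => 1 - pr t ω) =ᵐ[P] P[fun ω => 1 - A t ω | F t] := by
      have h := condExp_sub (integrable_const (μ := P) (1 : ℝ)) hAi (F t)
      rw [condExp_const (F.le t)] at h
      have h' : P[fun ω => 1 - A t ω | F t] =ᵐ[P] (fun _ => (1 : ℝ)) - P[A t | F t] := h
      filter_upwards [h', hprA t] with ω x y
      rw [x, y]; rfl
    obtain ⟨a0, b0⟩ := aux_pull (F.le t) P (fun ω => 1 - A t ω) g0 (fun ω => 1 - pr t ω)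
      ((integrable_const 1).sub hAi) hg0 hi0 hr0
    calc _ = ∫ ω, (A t ω * g1 ω + (1 - A t ω) * g0 ω) ∂P := by
          congr 1; funext ω
          rcases hAbin t ω with h | h <;> simp [h, hW, g1, g0]
      _ = ∫ ω, (pr t ω * g1 ω + (1 - pr t ω) * g0 ω) ∂P := by
          rw [integral_add hi1 hi0, integral_add a1 a0, b1, b0]
      _ = _ := by
          congr 1; funext ω
          have h1 : pr t ω ≠ 0 := (hpr01 t ω).1.ne'
          have h2 : 1 - pr t ω ≠ 0 := (sub_pos.2 (hpr01 t ω).2).ne'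
          simp only [g1, g0]
          field_simp
          ring
  have main : ∀ i j, M i j = ∫ ω, ∑ t ∈ Finset.Icc 1 T,
        ptil t ω * (1 - ptil t ω) * f t ω i * (Z t ω j - μ t ω j) ∂P := by
    intro i j
    rw [hM, integral_finsetSum _ (fun t _ => hInt₁ t i j),
      integral_finsetSum _ (fun t _ => hInt₂ t i j)]
    exact Finset.sum_congr rfl fun t _ => key t i j
  refine ⟨main, ?_⟩
  have hMO : ∀ i j, M i j = O j i := by
    intro i j
    rw [main, hO]
    congr 1; funext ω
    exact Finset.sum_congr rfl fun t _ => by ring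
  constructor
  · intro h
    ext j i
    have := congrFun (h (Pi.single j 1)) i
    rw [← hMO]
    simpa using this
  · intro h β
    have : M = 0 := by
      ext i j
      rw [hMO, h]; rfl
    rw [this, zero_mulVec]
end

section
/- (Core of Lemma 3.6: robustness of the lagged A2-WCLS estimating equation to the working model) For each t, the centered post-treatment sum satisfies E[L_t | F_{t+1}] = 0 almost surely, and consequently E[Σ_{t=1}^{T−Δ+1} W_t (A_t − p̃_t) L_t f_t] = 0. Hence, for any two collections of working models l and l⋆ with corresponding centered sums L_t and L_t⋆, one has E[Σ_{t=1}^{T−Δ+1} W_t (A_t − p̃_t)(L_t⋆ − L_t) f_t] = 0, so the population estimating function for the Δ-lag causal parameter β₀ does not depend on the choice of the working model l. -/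
open MeasureTheory ProbabilityTheory Matrix
open scoped BigOperators

theorem aux_term {Ω : Type*} [m𝒜 : MeasurableSpace Ω] (P : Measure Ω) [IsProbabilityMeasure P]
    (F : Filtration ℕ m𝒜) (A : ℕ → Ω → ℝ)
    (hA : ∀ s, Measurable[F (s + 1)] (A s))
    (hAbin : ∀ s ω, A s ω = 0 ∨ A s ω = 1)
    (pr : ℕ → Ω → ℝ)
    (hprMeas : ∀ s, Measurable[F s] (pr s))
    (hpr01 : ∀ s ω, pr s ω ∈ Set.Ioo (0 : ℝ) 1)
    (hprA : ∀ s, pr s =ᵐ[P] P[A s | F s])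
    (g : Ω → ℝ) (s r : ℕ) (hrs : r ≤ s)
    (hg : Measurable[F s] g) (hgi : Integrable g P) :
    Integrable ((A s - pr s) * g) P ∧ P[(A s - pr s) * g | F r] =ᵐ[P] 0 := by
  have mA : Measurable (A s) := (hA s).mono (F.le _) le_rfl
  have mp : Measurable (pr s) := (hprMeas s).mono (F.le _) le_rfl
  have hAi : Integrable (A s) P := by
    refine Integrable.of_bound mA.aestronglyMeasurable 1 (Filter.Eventually.of_forall fun ω => ?_)
    rcases hAbin s ω with h | h <;> simp [h]
  have hpi : Integrable (pr s) P := by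
    refine Integrable.of_bound mp.aestronglyMeasurable 1 (Filter.Eventually.of_forall fun ω => ?_)
    have := hpr01 s ω
    rw [Real.norm_eq_abs, abs_le]
    constructor <;> linarith [this.1, this.2]
  have hint : Integrable ((A s - pr s) * g) P := by
    refine hgi.bdd_mul (c := 1) (mA.sub mp).aestronglyMeasurable
      (Filter.Eventually.of_forall fun ω => ?_)
    have := hpr01 s ω
    rw [Real.norm_eq_abs, abs_le]
    rcases hAbin s ω with h | h <;> simp only [Pi.sub_apply, h] <;>
      constructor <;> linarith [this.1, this.2]
  refine ⟨hint, ?_⟩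
  have h1 : P[(A s - pr s) * g | F s] =ᵐ[P] P[A s - pr s | F s] * g :=
    condExp_mul_of_stronglyMeasurable_right hg.stronglyMeasurable hint (hAi.sub hpi)
  have h2 : P[A s - pr s | F s] =ᵐ[P] P[A s | F s] - P[pr s | F s] := condExp_sub hAi hpi _
  have h3 : P[pr s | F s] = pr s :=
    condExp_of_stronglyMeasurable (F.le s) (hprMeas s).stronglyMeasurable hpi
  have h4 : P[(A s - pr s) * g | F s] =ᵐ[P] 0 := by
    filter_upwards [h1, h2, hprA s] with ω e1 e2 e3
    rw [e1, Pi.mul_apply, e2, Pi.sub_apply, h3, e3]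
    simp
  have h5 := condExp_condExp_of_le (μ := P) (f := (A s - pr s) * g) (F.mono hrs) (F.le s)
  have h6 := condExp_congr_ae (m := F r) h4
  rw [condExp_zero] at h6
  exact h5.symm.trans h6

theorem aux_core {Ω : Type*} [m𝒜 : MeasurableSpace Ω] (P : Measure Ω) [IsProbabilityMeasure P]
    (F : Filtration ℕ m𝒜) (Δ : ℕ) (A : ℕ → Ω → ℝ)
    (hA : ∀ s, Measurable[F (s + 1)] (A s))
    (hAbin : ∀ s ω, A s ω = 0 ∨ A s ω = 1)
    (pr : ℕ → Ω → ℝ)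
    (hprMeas : ∀ s, Measurable[F s] (pr s))
    (hpr01 : ∀ s ω, pr s ω ∈ Set.Ioo (0 : ℝ) 1)
    (hprA : ∀ s, pr s =ᵐ[P] P[A s | F s])
    (l : ℕ → Bool → Ω → ℝ)
    (hl : ∀ s a, Measurable[F s] (l s a)) (hlInt : ∀ s a, Integrable (l s a) P)
    (L : ℕ → Ω → ℝ)
    (hL : ∀ t ω, L t ω = ∑ u ∈ Finset.Icc 1 (Δ - 1),
      ((A (t + u) ω * l (t + u) true ω + (1 - A (t + u) ω) * l (t + u) false ω)
        - (pr (t + u) ω * l (t + u) true ω + (1 - pr (t + u) ω) * l (t + u) false ω)))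
    (hIntL : ∀ t, Integrable (L t) P) (t : ℕ) :
    P[L t | F (t + 1)] =ᵐ[P] 0 ∧
    ∀ h : Ω → ℝ, Measurable[F (t + 1)] h → Integrable (h * L t) P → ∫ ω, h ω * L t ω ∂P = 0 := by
  have key : ∀ u ∈ Finset.Icc 1 (Δ - 1), _ := fun u hu =>
    aux_term P F A hA hAbin pr hprMeas hpr01 hprA (l (t + u) true - l (t + u) false) (t + u) (t + 1)
      (by have := (Finset.mem_Icc.1 hu).1; omega)
      ((hl _ _).sub (hl _ _)) ((hlInt _ _).sub (hlInt _ _))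
  have hLe : L t = ∑ u ∈ Finset.Icc 1 (Δ - 1),
      (A (t + u) - pr (t + u)) * (l (t + u) true - l (t + u) false) := by
    funext ω
    rw [hL, Finset.sum_apply]
    refine Finset.sum_congr rfl fun u _ => ?_
    simp only [Pi.mul_apply, Pi.sub_apply]
    ring
  have h0 : P[L t | F (t + 1)] =ᵐ[P] 0 := by
    rw [hLe]
    refine (condExp_finsetSum (fun u hu => (key u hu).1) _).trans ?_
    have : ∀ᵐ ω ∂P, ∀ u ∈ Finset.Icc 1 (Δ - 1),
        (P[(A (t + u) - pr (t + u)) * (l (t + u) true - l (t + u) false) | F (t + 1)]) ω = 0 :=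
      (Finset.eventually_all _).2 fun u hu => (key u hu).2
    filter_upwards [this] with ω hω
    rw [Finset.sum_apply]
    exact Finset.sum_eq_zero hω
  refine ⟨h0, fun h hm hi => ?_⟩
  have h1 : P[h * L t | F (t + 1)] =ᵐ[P] h * P[L t | F (t + 1)] :=
    condExp_mul_of_stronglyMeasurable_left hm.stronglyMeasurable hi (hIntL t)
  have h2 : ∫ ω, (h * L t) ω ∂P = 0 := by
    rw [← integral_condExp (F.le (t + 1))]
    refine integral_eq_zero_of_ae ?_
    filter_upwards [h1, h0] with ω e1 e2
    rw [e1, Pi.mul_apply, e2]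
    simp
  exact h2

/-- core of Lemma 3.6: for each `t`, the centered post-treatment sum satisfies
`E[L_t | F_{t+1}] = 0` a.s. and `E[Σ_t W_t (A_t − p̃_t) L_t f_t] = 0`; hence for any two
working-model collections `l, l⋆` with centered sums `L_t, L_t⋆`,
`E[Σ_t W_t (A_t − p̃_t)(L_t⋆ − L_t) f_t] = 0`, so the population estimating function for the
`Δ`-lag causal parameter `β₀` does not depend on the choice of working model. -/
theorem stmt_13
    {Ω : Type*} [m𝒜 : MeasurableSpace Ω] (P : Measure Ω) [IsProbabilityMeasure P]
    (F : Filtration ℕ m𝒜) (T q : ℕ) (Δ : ℕ) (hΔ : 2 ≤ Δ)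
    (A : ℕ → Ω → ℝ)
    (hA : ∀ s, Measurable[F (s + 1)] (A s))
    (hAbin : ∀ s ω, A s ω = 0 ∨ A s ω = 1)
    (pr : ℕ → Ω → ℝ)
    (hprMeas : ∀ s, Measurable[F s] (pr s))
    (hpr01 : ∀ s ω, pr s ω ∈ Set.Ioo (0 : ℝ) 1)
    (hprA : ∀ s, pr s =ᵐ[P] P[A s | F s])
    (𝒢 : ℕ → MeasurableSpace Ω) (h𝒢 : ∀ t, 𝒢 t ≤ F t)
    (ptil : ℕ → Ω → ℝ)
    (hptilMeas : ∀ t, Measurable[𝒢 t] (ptil t))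
    (hptil01 : ∀ t ω, ptil t ω ∈ Set.Ioo (0 : ℝ) 1)
    (W : ℕ → Ω → ℝ)
    (hW : ∀ t ω, W t ω
      = A t ω * (ptil t ω / pr t ω) + (1 - A t ω) * ((1 - ptil t ω) / (1 - pr t ω)))
    (f : ℕ → Ω → Fin q → ℝ) (hf : ∀ t, Measurable[𝒢 t] (f t))
    -- two working-model collections: `l s a` is `F_s`-measurable and integrable, `a ∈ {0,1}`
    (l lstar : ℕ → Bool → Ω → ℝ)
    (hl : ∀ s a, Measurable[F s] (l s a)) (hlInt : ∀ s a, Integrable (l s a) P)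
    (hlstar : ∀ s a, Measurable[F s] (lstar s a))
    (hlstarInt : ∀ s a, Integrable (lstar s a) P)
    -- evaluation at the random treatment and conditional-mean centering
    (L Lstar : ℕ → Ω → ℝ)
    (hL : ∀ t ω, L t ω = ∑ u ∈ Finset.Icc 1 (Δ - 1),
      ((A (t + u) ω * l (t + u) true ω + (1 - A (t + u) ω) * l (t + u) false ω)
        - (pr (t + u) ω * l (t + u) true ω + (1 - pr (t + u) ω) * l (t + u) false ω)))
    (hLstar : ∀ t ω, Lstar t ω = ∑ u ∈ Finset.Icc 1 (Δ - 1),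
      ((A (t + u) ω * lstar (t + u) true ω + (1 - A (t + u) ω) * lstar (t + u) false ω)
        - (pr (t + u) ω * lstar (t + u) true ω + (1 - pr (t + u) ω) * lstar (t + u) false ω)))
    -- all displayed products are integrable
    (hIntL : ∀ t, Integrable (L t) P) (hIntLstar : ∀ t, Integrable (Lstar t) P)
    (hIntWL : ∀ t i, Integrable (fun ω => W t ω * (A t ω - ptil t ω) * L t ω * f t ω i) P)
    (hIntWLstar : ∀ t i,
      Integrable (fun ω => W t ω * (A t ω - ptil t ω) * Lstar t ω * f t ω i) P) :
    (∀ t ∈ Finset.Icc 1 (T - Δ + 1), P[L t | F (t + 1)] =ᵐ[P] fun _ => (0 : ℝ)) ∧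
    (∀ i : Fin q, (∫ ω, ∑ t ∈ Finset.Icc 1 (T - Δ + 1),
      W t ω * (A t ω - ptil t ω) * L t ω * f t ω i ∂P) = 0) ∧
    (∀ i : Fin q, (∫ ω, ∑ t ∈ Finset.Icc 1 (T - Δ + 1),
      W t ω * (A t ω - ptil t ω) * (Lstar t ω - L t ω) * f t ω i ∂P) = 0) := by
  have c1 := aux_core P F Δ A hA hAbin pr hprMeas hpr01 hprA l hl hlInt L hL hIntL
  have c2 := aux_core P F Δ A hA hAbin pr hprMeas hpr01 hprA lstar hlstar hlstarInt Lstar hLstar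
    hIntLstar
  have hm : ∀ t i, Measurable[F (t + 1)] (fun ω => W t ω * (A t ω - ptil t ω) * f t ω i) := by
    intro t i
    have le1 : F t ≤ F (t + 1) := F.mono (Nat.le_succ t)
    have a1 := hA t
    have a2 : Measurable[F (t + 1)] (pr t) := (hprMeas t).mono le1 le_rfl
    have a3 : Measurable[F (t + 1)] (ptil t) := (hptilMeas t).mono ((h𝒢 t).trans le1) le_rfl
    have a4 : Measurable[F (t + 1)] (f t) := (hf t).mono ((h𝒢 t).trans le1) le_rfl
    have a5 : Measurable[F (t + 1)] (fun ω => f t ω i) := (measurable_pi_apply i).comp a4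
    simp only [hW]
    exact (((a1.mul (a3.div a2)).add ((a1.const_sub 1).mul
      ((a3.const_sub 1).div (a2.const_sub 1)))).mul (a1.sub a3)).mul a5
  have z1 : ∀ t i, ∫ ω, W t ω * (A t ω - ptil t ω) * L t ω * f t ω i ∂P = 0 := by
    intro t i
    have e : (fun ω => W t ω * (A t ω - ptil t ω) * L t ω * f t ω i)
        = (fun ω => W t ω * (A t ω - ptil t ω) * f t ω i) * L t := by
      funext ω; simp only [Pi.mul_apply]; ring
    have := (c1 t).2 _ (hm t i) (e ▸ hIntWL t i)
    rw [e]; exact this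
  have z2 : ∀ t i, ∫ ω, W t ω * (A t ω - ptil t ω) * Lstar t ω * f t ω i ∂P = 0 := by
    intro t i
    have e : (fun ω => W t ω * (A t ω - ptil t ω) * Lstar t ω * f t ω i)
        = (fun ω => W t ω * (A t ω - ptil t ω) * f t ω i) * Lstar t := by
      funext ω; simp only [Pi.mul_apply]; ring
    have := (c2 t).2 _ (hm t i) (e ▸ hIntWLstar t i)
    rw [e]; exact this
  refine ⟨fun t _ => (c1 t).1, fun i => ?_, fun i => ?_⟩
  · rw [integral_finsetSum _ fun t _ => hIntWL t i]
    exact Finset.sum_eq_zero fun t _ => z1 t i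
  · have e : ∀ t ω, W t ω * (A t ω - ptil t ω) * (Lstar t ω - L t ω) * f t ω i
        = W t ω * (A t ω - ptil t ω) * Lstar t ω * f t ω i
          - W t ω * (A t ω - ptil t ω) * L t ω * f t ω i := fun t ω => by ring
    simp only [e]
    refine (integral_finsetSum _ fun t _ => (hIntWLstar t i).sub (hIntWL t i)).trans ?_
    refine Finset.sum_eq_zero fun t _ => ?_
    refine (integral_sub (hIntWLstar t i) (hIntWL t i)).trans ?_
    rw [z1, z2, sub_zero]
end
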